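/- Let G be a connected graph with positive edge lengths ℓ, let H be a convex subgraph of G, let 0 < δ ≤ ε(G,ℓ), and let d̂_G be the corresponding perturbed distance. Then for all x, y ∈ V(H), d̂_G(x,y) = d_H(x,y). -/

import Mathlib

open scoped ENNReal

namespace PaperIso

variable {V : Type*}

/-- The length of a walk: sum of the lengths of its edges (with multiplicity). -/
noncomputable def wLen {G : SimpleGraph V} (ℓ : Sym2 V → ℝ≥0∞) {x y : V} (w : G.Walk x y) :
    ℝ≥0∞ :=
  (w.edges.map ℓ).sum

/-- The weighted distance in `G`: the infimum of the lengths of walks from `x` to `y`;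
it equals `⊤` when there is no walk from `x` to `y`. -/
noncomputable def eDist (G : SimpleGraph V) (ℓ : Sym2 V → ℝ≥0∞) (x y : V) : ℝ≥0∞ :=
  ⨅ w : G.Walk x y, wLen ℓ w

/-- The edge lengths are positive reals (positive and finite) on every edge of `G`. -/
def PosLengths (G : SimpleGraph V) (ℓ : Sym2 V → ℝ≥0∞) : Prop :=
  ∀ e ∈ G.edgeSet, 0 < ℓ e ∧ ℓ e < ⊤

/-- The boundary `∂H`: vertices of `H` incident to some edge of `E(G) \ E(H)`. -/
def boundary (G : SimpleGraph V) (H : G.Subgraph) : Set V :=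
  {v | v ∈ H.verts ∧ ∃ u, G.Adj v u ∧ ¬ H.Adj v u}

/-- `H` is an isometric subgraph of `G` (with respect to lengths `ℓ`). -/
def IsIsometric (G : SimpleGraph V) (ℓ : Sym2 V → ℝ≥0∞) (H : G.Subgraph) : Prop :=
  ∀ x ∈ H.verts, ∀ y ∈ H.verts, eDist H.spanningCoe ℓ x y = eDist G ℓ x y

/-- `p` is a minimum-length (shortest) path with respect to lengths `ℓ`. -/
def IsShortestPath (G : SimpleGraph V) (ℓ : Sym2 V → ℝ≥0∞) {x y : V} (p : G.Walk x y) : Prop :=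
  p.IsPath ∧ ∀ q : G.Walk x y, q.IsPath → wLen ℓ p ≤ wLen ℓ q

/-- `H` is a (geodesically) convex subgraph of `G`: every minimum-length path of `G`
between vertices of `H` is contained in `H`. -/
def IsConvex (G : SimpleGraph V) (ℓ : Sym2 V → ℝ≥0∞) (H : G.Subgraph) : Prop :=
  ∀ x ∈ H.verts, ∀ y ∈ H.verts, ∀ p : G.Walk x y, IsShortestPath G ℓ p → p.toSubgraph ≤ H

/-- `ε(G,ℓ) = (1/n) · min{ℓ(π) − ℓ(π') : π, π' paths of G with ℓ(π) > ℓ(π')}`. -/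
noncomputable def eps [Fintype V] (G : SimpleGraph V) (ℓ : Sym2 V → ℝ≥0∞) : ℝ≥0∞ :=
  (⨅ (x : V) (y : V) (x' : V) (y' : V) (p : G.Path x y) (q : G.Path x' y')
      (_ : wLen ℓ (q : G.Walk x' y') < wLen ℓ (p : G.Walk x y)),
      (wLen ℓ (p : G.Walk x y) - wLen ℓ (q : G.Walk x' y'))) / (Fintype.card V : ℝ≥0∞)

open scoped Classical in
/-- The perturbed lengths `ℓ̂`: edges not in `H` are shortened by `δ`. -/
noncomputable def pert {G : SimpleGraph V} (H : G.Subgraph) (ℓ : Sym2 V → ℝ≥0∞) (δ : ℝ≥0∞) :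
    Sym2 V → ℝ≥0∞ :=
  fun e => if e ∈ H.edgeSet then ℓ e else ℓ e - δ

theorem exists_shortest [Finite V] (G : SimpleGraph V) (ℓ : Sym2 V → ℝ≥0∞)
    (hG : G.Connected) (x y : V) : ∃ p : G.Walk x y, IsShortestPath G ℓ p := by
  classical
  have := Fintype.ofFinite V
  have : Nonempty (G.Path x y) := ⟨(hG.preconnected x y).some.toPath⟩
  obtain ⟨p, hp⟩ := Finite.exists_min (fun p : G.Path x y => wLen ℓ (p : G.Walk x y))
  exact ⟨p, p.2, fun q hq => hp ⟨q, hq⟩⟩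

theorem wLen_bypass_le [DecidableEq V] {G : SimpleGraph V} (ℓ : Sym2 V → ℝ≥0∞) {x y : V}
    (w : G.Walk x y) : wLen ℓ w.bypass ≤ wLen ℓ w := by
  unfold wLen
  exact (w.edges_bypass_sublist_edges.map ℓ).sum_le_sum (by simp)

theorem eDist_le_of_toSubgraph {G : SimpleGraph V} (ℓ : Sym2 V → ℝ≥0∞) (H : G.Subgraph)
    {x y : V} (p : G.Walk x y) (h : ∀ e ∈ p.edges, e ∈ H.edgeSet) :
    eDist H.spanningCoe ℓ x y ≤ wLen ℓ p := by
  refine (iInf_le _ (p.transfer H.spanningCoe (by simpa using h))).trans ?_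
  simp [wLen]

theorem wLen_pert_eq {G : SimpleGraph V} (ℓ : Sym2 V → ℝ≥0∞) (H : G.Subgraph) (δ : ℝ≥0∞)
    {x y : V} (p : G.Walk x y) (h : ∀ e ∈ p.edges, e ∈ H.edgeSet) :
    wLen (pert H ℓ δ) p = wLen ℓ p := by
  unfold wLen
  congr 1
  exact List.map_congr_left fun e he => by simp [pert, h e he]

theorem wLen_le_pert {G : SimpleGraph V} (ℓ : Sym2 V → ℝ≥0∞) (H : G.Subgraph) (δ : ℝ≥0∞)
    {x y : V} (p : G.Walk x y) :
    wLen ℓ p ≤ wLen (pert H ℓ δ) p + p.length * δ := by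
  rw [← p.length_edges]
  unfold wLen
  induction p.edges with
  | nil => simp
  | cons e l ih =>
    have he : ℓ e ≤ pert H ℓ δ e + δ := by
      unfold pert
      split_ifs
      · exact le_self_add
      · exact le_tsub_add
    simp only [List.map_cons, List.sum_cons, List.length_cons, Nat.cast_add, Nat.cast_one]
    refine (add_le_add he ih).trans (le_of_eq ?_)
    ring

theorem wLen_lt_top {G : SimpleGraph V} (ℓ : Sym2 V → ℝ≥0∞) (hℓ : PosLengths G ℓ)
    {x y : V} (p : G.Walk x y) : wLen ℓ p < ⊤ := by
  have h : ∀ e ∈ p.edges, ℓ e < ⊤ := fun e he => (hℓ e (p.edges_subset_edgeSet he)).2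
  unfold wLen
  revert h
  induction p.edges with
  | nil => simp
  | cons e l ih =>
    intro h
    simp only [List.map_cons, List.sum_cons]
    exact ENNReal.add_lt_top.2 ⟨h e (by simp), ih fun e he => h e (by simp [he])⟩

theorem convex_pert_dist [Fintype V] (G : SimpleGraph V) (ℓ : Sym2 V → ℝ≥0∞)
    (hG : G.Connected) (hℓ : PosLengths G ℓ) (H : G.Subgraph)
    (hconv : IsConvex G ℓ H)
    (δ : ℝ≥0∞) (hδ0 : 0 < δ) (hδ : δ ≤ eps G ℓ) :
    ∀ x ∈ H.verts, ∀ y ∈ H.verts,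
      eDist G (pert H ℓ δ) x y = eDist H.spanningCoe ℓ x y := by
  classical
  intro x hx y hy
  have hc : ∀ p : G.Walk x y, IsShortestPath G ℓ p → ∀ e ∈ p.edges, e ∈ H.edgeSet := by
    intro p hp e he
    exact SimpleGraph.Subgraph.edgeSet_mono (hconv x hx y hy p hp)
      (by simpa using he)
  obtain ⟨s, hs⟩ := exists_shortest G ℓ hG x y
  apply le_antisymm
  · refine le_iInf fun w => ?_
    have hw : ∀ e ∈ w.edges, e ∈ H.edgeSet := fun e he => by
      simpa using w.edges_subset_edgeSet he
    have hwG : ∀ e ∈ w.edges, e ∈ G.edgeSet := fun e he => H.edgeSet_subset (hw e he)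
    refine (iInf_le _ (w.transfer G hwG)).trans ?_
    rw [wLen_pert_eq ℓ H δ _ (by simpa using hw)]
    simp [wLen]
  · refine le_iInf fun w => ?_
    refine le_trans ?_ (wLen_bypass_le _ w)
    refine (eDist_le_of_toSubgraph ℓ H s (hc s hs)).trans ?_
    have hp := w.bypass_isPath
    generalize w.bypass = p at hp
    rcases (hs.2 p hp).eq_or_lt with h | h
    · rw [wLen_pert_eq ℓ H δ p (hc p ⟨hp, fun q hq => h ▸ hs.2 q hq⟩), h]
    · have h1 : δ * Fintype.card V ≤ wLen ℓ p - wLen ℓ s := by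
        refine (ENNReal.le_div_iff_mul_le (Or.inl ?_) (Or.inl ?_)).1 (hδ.trans ?_)
        · exact_mod_cast (Fintype.card_pos_iff.2 ⟨x⟩).ne'
        · exact ENNReal.natCast_ne_top _
        · unfold eps
          gcongr
          exact (iInf_le_of_le x <| iInf_le_of_le y <| iInf_le_of_le x <| iInf_le_of_le y <|
            iInf_le_of_le ⟨p, hp⟩ <| iInf_le_of_le ⟨s, hs.1⟩ <| iInf_le_of_le h le_rfl)
      have h2 : (p.length : ℝ≥0∞) * δ ≤ wLen ℓ p - wLen ℓ s := by
        refine le_trans ?_ h1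
        rw [mul_comm]
        gcongr
        exact hp.length_lt.le
      have hfin : (p.length : ℝ≥0∞) * δ ≠ ⊤ :=
        ((h2.trans tsub_le_self).trans_lt (wLen_lt_top ℓ hℓ p)).ne
      refine (ENNReal.add_le_add_iff_right hfin).1 ?_
      calc _ ≤ wLen ℓ s + (wLen ℓ p - wLen ℓ s) := by gcongr
        _ = wLen ℓ p := add_tsub_cancel_of_le h.le
        _ ≤ _ := wLen_le_pert ℓ H δ p

end PaperIso
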